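/- For each a ∈ {2, 4, 8}, in the polynomial ring ℤ[X] the product (X² − 1)(X^{a/2+2} − 1) divides the product (X^{3a/2+2} − 1)(X^{2a+2} − 1)(X^{2a+4} − 1)(X^{5a/2+4} − 1)(X^{3a+6} − 1), and the quotient has degree (21a + 28)/2. Consequently Z_{g₂}(q) = q^{3a/2+2} · (that quotient evaluated at q) is a polynomial in q of degree 12a + 16, which equals the dimension of the nilpotent orbit O_a of the series labeled g₂. -/

import Mathlib

/-!
STATEMENT 10.
For each `a ∈ {2,4,8}`, in `ℤ[X]` the product `(X²−1)(X^{a/2+2}−1)` divides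
`(X^{3a/2+2}−1)(X^{2a+2}−1)(X^{2a+4}−1)(X^{5a/2+4}−1)(X^{3a+6}−1)`,
the quotient `Q` has degree `(21a+28)/2`, and
`Z_{g₂}(q) = q^{3a/2+2}·Q(q)` is a polynomial in `q` of degree `12a+16`,
the dimension of the nilpotent orbit `O_a` of the series labeled `g₂`.
-/

open Polynomial

theorem X_pow_sub_one_dvd_of_dvd {R : Type*} [CommRing R] {m n : ℕ} (h : m ∣ n) :
    (X ^ m - 1 : R[X]) ∣ X ^ n - 1 := by
  obtain ⟨k, rfl⟩ := h
  simpa [pow_mul] using sub_dvd_pow_sub_pow (X ^ m : R[X]) 1 k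

theorem monic_X_pow_sub_one {R : Type*} [CommRing R] {n : ℕ} (hn : n ≠ 0) :
    (X ^ n - 1 : R[X]).Monic := by
  simpa using monic_X_pow_sub_C (1 : R) hn

theorem natDegree_X_pow_sub_one {R : Type*} [CommRing R] [Nontrivial R] (n : ℕ) :
    (X ^ n - 1 : R[X]).natDegree = n := by
  simpa using natDegree_X_pow_sub_C (n := n) (r := (1 : R))

theorem natDegree_add_of_prod_X_pow_sub_one_eq {R : Type*} [CommRing R] [Nontrivial R]
    {b c d e f m n : ℕ} (hb : b ≠ 0) (hc : c ≠ 0) (hd : d ≠ 0) (he : e ≠ 0) (hf : f ≠ 0)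
    (hm : m ≠ 0) (hn : n ≠ 0) {Q : R[X]}
    (h : (X ^ b - 1) * (X ^ c - 1) * (X ^ d - 1) * (X ^ e - 1) * (X ^ f - 1)
      = (X ^ m - 1) * (X ^ n - 1) * Q) :
    Q ≠ 0 ∧ m + n + Q.natDegree = b + c + d + e + f := by
  have hb' := monic_X_pow_sub_one (R := R) hb
  have hc' := hb'.mul (monic_X_pow_sub_one (R := R) hc)
  have hd' := hc'.mul (monic_X_pow_sub_one (R := R) hd)
  have he' := hd'.mul (monic_X_pow_sub_one (R := R) he)
  have hf' := he'.mul (monic_X_pow_sub_one (R := R) hf)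
  have hm' := monic_X_pow_sub_one (R := R) hm
  have hn' := hm'.mul (monic_X_pow_sub_one (R := R) hn)
  have hQ : Q ≠ 0 := by
    rintro rfl
    exact hf'.ne_zero (by rw [h, mul_zero])
  have hdeg := congrArg natDegree h
  rw [he'.natDegree_mul (monic_X_pow_sub_one hf), hd'.natDegree_mul (monic_X_pow_sub_one he),
    hc'.natDegree_mul (monic_X_pow_sub_one hd), hb'.natDegree_mul (monic_X_pow_sub_one hc),
    hn'.natDegree_mul' hQ, hm'.natDegree_mul (monic_X_pow_sub_one hn)] at hdeg
  simp only [natDegree_X_pow_sub_one] at hdeg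
  exact ⟨hQ, hdeg.symm⟩

theorem rational_points_g2_series_polynomial :
    ∀ a ∈ ({2, 4, 8} : Set ℕ),
      ∃ Q : Polynomial ℤ,
        (X ^ (3 * a / 2 + 2) - 1) * (X ^ (2 * a + 2) - 1) * (X ^ (2 * a + 4) - 1) *
            (X ^ (5 * a / 2 + 4) - 1) * (X ^ (3 * a + 6) - 1)
          = (X ^ 2 - 1) * (X ^ (a / 2 + 2) - 1) * Q
        ∧ Q.natDegree = (21 * a + 28) / 2
        ∧ ((X : Polynomial ℤ) ^ (3 * a / 2 + 2) * Q).natDegree = 12 * a + 16 := by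
  intro a ha
  have hdvd : (X ^ 2 - 1) * (X ^ (a / 2 + 2) - 1) ∣
      ((X : ℤ[X]) ^ (3 * a / 2 + 2) - 1) * (X ^ (2 * a + 2) - 1) * (X ^ (2 * a + 4) - 1) *
        (X ^ (5 * a / 2 + 4) - 1) * (X ^ (3 * a + 6) - 1) := by
    rcases ha with rfl | rfl | rfl <;> norm_num only
    · exact (mul_dvd_mul (((X_pow_sub_one_dvd_of_dvd (by norm_num)).mul_left _).mul_right _)
        (X_pow_sub_one_dvd_of_dvd (by norm_num))).mul_right _
    · exact ((mul_dvd_mul ((X_pow_sub_one_dvd_of_dvd (by norm_num)).mul_left _)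
        (X_pow_sub_one_dvd_of_dvd (by norm_num))).mul_right _).mul_right _
    · exact (((mul_dvd_mul (X_pow_sub_one_dvd_of_dvd (by norm_num))
        (X_pow_sub_one_dvd_of_dvd (by norm_num))).mul_right _).mul_right _).mul_right _
  obtain ⟨Q, hQ⟩ := hdvd
  obtain ⟨hQ0, hdeg⟩ := natDegree_add_of_prod_X_pow_sub_one_eq (by lia) (by lia) (by lia)
    (by lia) (by lia) (by lia) (by lia) hQ
  refine ⟨Q, hQ, ?_, ?_⟩
  · rcases ha with rfl | rfl | rfl <;> lia
  · rw [(monic_X_pow _).natDegree_mul' hQ0, natDegree_X_pow]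
    rcases ha with rfl | rfl | rfl <;> lia
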